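/- Let S be an m×n real matrix and v ∈ ℝⁿ with S·v = 0 and v_j ≥ 0 for all j. Fix a row index i (an internal metabolite). If v_j = 0 for every reaction j producing metabolite i (i.e. every j with S_{ij} > 0), then v_k = 0 for every reaction k consuming metabolite i (i.e. every k with S_{ik} < 0). (This is the soundness of the discard rule in Step 4 / Proposition 4: a pathway in which some internal metabolite receives zero production cannot carry positive flux through any reaction consuming that metabolite.) -/

import Mathlib

/-- Soundness of the discard rule: if a nonnegative steady-state flux vector
gives zero flux to every reaction producing metabolite `i`, then every
reaction consuming metabolite `i` also carries zero flux. -/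
theorem no_production_no_consumption {m n : ℕ}
    (S : Matrix (Fin m) (Fin n) ℝ) (v : Fin n → ℝ)
    (hss : S.mulVec v = 0) (hnn : ∀ j, 0 ≤ v j) (i : Fin m)
    (hprod : ∀ j, 0 < S i j → v j = 0) :
    ∀ k, S i k < 0 → v k = 0 := by
  intro k hk
  have hsum : ∑ j, S i j * v j = 0 := congrFun hss i
  have hle : ∀ j ∈ Finset.univ, S i j * v j ≤ 0 := by
    intro j _
    rcases lt_or_ge 0 (S i j) with h | h
    · rw [hprod j h, mul_zero]
    · exact mul_nonpos_of_nonpos_of_nonneg h (hnn j)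
  have hz := (Finset.sum_eq_zero_iff_of_nonpos hle).1 hsum k (Finset.mem_univ k)
  exact (mul_eq_zero.1 hz).resolve_left hk.ne
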